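/- The distance from the 6-variable Boolean function f₅ = X₁X₂X₃ + X₂X₄X₅ + X₃X₄X₆ to RM(2,6) equals 16; that is, the minimum over Boolean functions p of degree at most 2 of the weight of f₅ + p is 16. -/

import Mathlib

open MvPolynomial

/-- A Boolean function on `m` variables over 𝔽₂. -/
abbrev BF (m : ℕ) := (Fin m → ZMod 2) → ZMod 2

/-- The unique multilinear polynomial over 𝔽₂ representing the Boolean function `f`
(obtained by interpolation: `∏ i (Xᵢ + vᵢ + 1)` is the indicator of the input `v`). -/
noncomputable def repPoly {m : ℕ} (f : BF m) : MvPolynomial (Fin m) (ZMod 2) :=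
  ∑ v : Fin m → ZMod 2, f v • ∏ i : Fin m, (X i + C (v i + 1))

/-- The degree of a Boolean function: the total degree of its multilinear representative. -/
noncomputable def deg {m : ℕ} (f : BF m) : ℕ := (repPoly f).totalDegree

/-- The weight of a Boolean function: the number of inputs on which it takes the value 1. -/
noncomputable def wt {m : ℕ} (f : BF m) : ℕ :=
  (Finset.univ.filter fun v => f v = 1).card

/-- The distance from `f` to the Reed–Muller code `RM(r,m)`: the minimum weight of
`f + p` over Boolean functions `p` of degree at most `r`. -/
noncomputable def distRM (m r : ℕ) (f : BF m) : ℕ :=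
  sInf {w | ∃ p : BF m, deg p ≤ r ∧ wt (f + p) = w}

/-- The quadratic Boolean polynomial in three variables with the given coefficients. -/
def ternaryQuadratic (k α β γ r s t x y z : ZMod 2) : ZMod 2 :=
  k + α * x + β * y + γ * z + r * (x * y) + s * (x * z) + t * (y * z)

theorem two_le_sum_ternaryQuadratic (k α β γ r s t : ZMod 2) (h : (r, s, t) ≠ 0) :
    2 ≤ ∑ x, ∑ y, ∑ z, (ternaryQuadratic k α β γ r s t x y z).val := by
  revert k α β γ r s t
  decide +kernel

theorem sum_dot_le_sum_ternaryQuadratic (k α β γ : ZMod 2) :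
    ∑ r : ZMod 2, ∑ s : ZMod 2, ∑ t : ZMod 2, (r * α + s * β + t * γ).val ≤
      ∑ x, ∑ y, ∑ z, (ternaryQuadratic k α β γ 0 0 0 x y z).val := by
  revert k α β γ
  decide +kernel

theorem four_dvd_sum_dot (α β γ : ZMod 2) :
    4 ∣ ∑ r : ZMod 2, ∑ s : ZMod 2, ∑ t : ZMod 2, (r * α + s * β + t * γ).val := by
  revert α β γ
  decide +kernel

/-- The three products `ab`, `ac`, `bc`, each perturbed by an affine function, vanish
simultaneously on at most half of the cube. -/
theorem sixteen_le_sum_sum_dot (A B C : Fin 4 → ZMod 2) :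
    16 ≤ ∑ a : ZMod 2, ∑ b : ZMod 2, ∑ c : ZMod 2,
      ∑ r : ZMod 2, ∑ s : ZMod 2, ∑ t : ZMod 2,
        (r * (a * b + A 0 + A 1 * a + A 2 * b + A 3 * c) +
          s * (a * c + B 0 + B 1 * a + B 2 * b + B 3 * c) +
          t * (b * c + C 0 + C 1 * a + C 2 * b + C 3 * c)).val := by
  set S := ∑ a : ZMod 2, ∑ b : ZMod 2, ∑ c : ZMod 2,
      ∑ r : ZMod 2, ∑ s : ZMod 2, ∑ t : ZMod 2,
        (r * (a * b + A 0 + A 1 * a + A 2 * b + A 3 * c) +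
          s * (a * c + B 0 + B 1 * a + B 2 * b + B 3 * c) +
          t * (b * c + C 0 + C 1 * a + C 2 * b + C 3 * c)).val with hS
  have hdvd : 4 ∣ S := Finset.dvd_sum fun a _ => Finset.dvd_sum fun b _ =>
    Finset.dvd_sum fun c _ => four_dvd_sum_dot _ _ _
  have hswap : S = ∑ w : ZMod 2 × ZMod 2 × ZMod 2, ∑ a : ZMod 2, ∑ b : ZMod 2, ∑ c : ZMod 2,
      (ternaryQuadratic (w.1 * A 0 + w.2.1 * B 0 + w.2.2 * C 0)
        (w.1 * A 1 + w.2.1 * B 1 + w.2.2 * C 1) (w.1 * A 2 + w.2.1 * B 2 + w.2.2 * C 2)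
        (w.1 * A 3 + w.2.1 * B 3 + w.2.2 * C 3) w.1 w.2.1 w.2.2 a b c).val := by
    trans ∑ e : ZMod 2 × ZMod 2 × ZMod 2, ∑ w : ZMod 2 × ZMod 2 × ZMod 2,
      (ternaryQuadratic (w.1 * A 0 + w.2.1 * B 0 + w.2.2 * C 0)
        (w.1 * A 1 + w.2.1 * B 1 + w.2.2 * C 1) (w.1 * A 2 + w.2.1 * B 2 + w.2.2 * C 2)
        (w.1 * A 3 + w.2.1 * B 3 + w.2.2 * C 3) w.1 w.2.1 w.2.2 e.1 e.2.1 e.2.2).val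
    · simp only [hS, Fintype.sum_prod_type]
      refine Finset.sum_congr rfl fun a _ => Finset.sum_congr rfl fun b _ =>
        Finset.sum_congr rfl fun c _ => Finset.sum_congr rfl fun r _ =>
        Finset.sum_congr rfl fun s _ => Finset.sum_congr rfl fun t _ => congrArg ZMod.val ?_
      rw [ternaryQuadratic]
      ring
    · rw [Finset.sum_comm]
      simp only [Fintype.sum_prod_type]
  have hle : ∑ w : ZMod 2 × ZMod 2 × ZMod 2, (if w = 0 then 0 else 2) ≤ S := by
    rw [hswap]
    refine Finset.sum_le_sum fun w _ => ?_
    split_ifs with hw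
    · exact Nat.zero_le _
    · exact two_le_sum_ternaryQuadratic _ _ _ _ _ _ _ hw
  have h14 : ∑ w : ZMod 2 × ZMod 2 × ZMod 2, (if w = 0 then 0 else 2) = 14 := by decide +kernel
  omega

/-- Reindexing a sum over sextuples by an explicit ordering of the coordinates. -/
theorem sum_fin_six_fun {α : Type*} [Fintype α] (F : (Fin 6 → α) → ℕ) :
    ∑ v, F v = ∑ a, ∑ b, ∑ c, ∑ x, ∑ y, ∑ z, F ![x, a, b, c, y, z] := by
  let e : α × α × α × α × α × α ≃ (Fin 6 → α) :=
    { toFun := fun w => ![w.2.2.2.1, w.1, w.2.1, w.2.2.1, w.2.2.2.2.1, w.2.2.2.2.2]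
      invFun := fun v => (v 1, v 2, v 3, v 0, v 4, v 5)
      left_inv := fun _ => rfl
      right_inv := fun v => by ext i; fin_cases i <;> rfl }
  rw [← e.sum_comp F]
  simp only [Fintype.sum_prod_type]
  rfl

/-- The Boolean functions given by a polynomial expression of degree at most two. -/
def IsQuadratic {m : ℕ} (p : BF m) : Prop :=
  ∃ (k : ZMod 2) (l : Fin m → ZMod 2) (q : Fin m → Fin m → ZMod 2),
    ∀ v, p v = k + ∑ i, l i * v i + ∑ i, ∑ j, q i j * (v i * v j)

theorem IsQuadratic.add {m : ℕ} {p p' : BF m} (hp : IsQuadratic p) (hp' : IsQuadratic p') :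
    IsQuadratic (p + p') := by
  obtain ⟨k, l, q, h⟩ := hp
  obtain ⟨k', l', q', h'⟩ := hp'
  refine ⟨k + k', l + l', q + q', fun v => ?_⟩
  simp only [Pi.add_apply, h, h', add_mul, Finset.sum_add_distrib]
  ring

theorem IsQuadratic.sum {m : ℕ} {ι : Type*} (s : Finset ι) (p : ι → BF m)
    (h : ∀ i ∈ s, IsQuadratic (p i)) : IsQuadratic (∑ i ∈ s, p i) :=
  Finset.sum_induction p IsQuadratic (fun _ _ => IsQuadratic.add)
    ⟨0, 0, 0, fun v => by simp⟩ h

theorem isQuadratic_monomial {m : ℕ} (d : Fin m →₀ ℕ) (c : ZMod 2)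
    (hd : (d.sum fun _ e => e) ≤ 2) : IsQuadratic fun v => eval v (monomial d c) := by
  obtain ⟨s, rfl⟩ := Multiset.toFinsupp.surjective d
  have hs : s.card ≤ 2 := (Multiset.toFinsupp_sum_eq s).symm.trans_le hd
  have heval : ∀ v : Fin m → ZMod 2,
      eval v (monomial (Multiset.toFinsupp s) c) = c * (s.map v).prod := by
    intro v
    simp [eval_monomial, Finset.prod_multiset_map_count, Finsupp.prod]
  interval_cases h : s.card
  · obtain rfl := Multiset.card_eq_zero.1 h
    exact ⟨c, 0, 0, fun v => (heval v).trans (by simp)⟩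
  · obtain ⟨i, rfl⟩ := Multiset.card_eq_one.1 h
    refine ⟨0, Pi.single i c, 0, fun v => ?_⟩
    refine (heval v).trans ?_
    simp [Pi.single_apply]
  · obtain ⟨i, j, rfl⟩ := Multiset.card_eq_two.1 h
    refine ⟨0, 0, fun i' j' => if i' = i ∧ j' = j then c else 0, fun v => ?_⟩
    refine (heval v).trans ?_
    simp [ite_and]

theorem eval_repPoly {m : ℕ} (p : BF m) (v : Fin m → ZMod 2) : eval v (repPoly p) = p v := by
  have hind : ∀ w : Fin m → ZMod 2, ∏ i, (v i + (w i + 1)) = if v = w then 1 else 0 := by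
    intro w
    have h01 : ∀ a b : ZMod 2, a + (b + 1) = if a = b then 1 else 0 := by decide
    simp only [h01, Finset.prod_ite_zero, Finset.mem_univ, true_imp_iff, Finset.prod_const_one,
      _root_.funext_iff]
  simp [repPoly, smul_eval, hind]

theorem isQuadratic_of_deg_le_two {m : ℕ} {p : BF m} (hp : deg p ≤ 2) : IsQuadratic p := by
  have hsum : p = ∑ d ∈ (repPoly p).support,
      fun v => eval v (monomial d (coeff d (repPoly p))) := by
    ext v
    rw [Finset.sum_apply, ← map_sum, ← as_sum, eval_repPoly]
  rw [hsum]
  exact IsQuadratic.sum _ _ fun d hd =>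
    isQuadratic_monomial _ _ ((le_totalDegree hd).trans hp)

theorem wt_eq_sum_val {m : ℕ} (p : BF m) : wt p = ∑ v, (p v).val := by
  have hval : ∀ a : ZMod 2, a.val = if a = 1 then 1 else 0 := by decide
  simp only [wt, hval, Finset.card_filter]

theorem sixteen_le_wt_add_of_isQuadratic {p : BF 6} (hp : IsQuadratic p) :
    16 ≤ wt ((fun v : Fin 6 → ZMod 2 =>
      v 0 * v 1 * v 2 + v 1 * v 3 * v 4 + v 2 * v 3 * v 5) + p) := by
  obtain ⟨k, l, q, h⟩ := hp
  have hsq : ∀ a : ZMod 2, a * a = a := by decide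
  let u : Fin 6 → ZMod 2 → ZMod 2 → ZMod 2 → ZMod 2 := fun i a b c =>
    (l i + q i i) + (q i 1 + q 1 i) * a + (q i 2 + q 2 i) * b + (q i 3 + q 3 i) * c
  have hblock : ∀ a b c : ZMod 2, ∃ k', ∀ x y z : ZMod 2,
      ((fun v : Fin 6 → ZMod 2 =>
        v 0 * v 1 * v 2 + v 1 * v 3 * v 4 + v 2 * v 3 * v 5) + p) ![x, a, b, c, y, z] =
      ternaryQuadratic k' (a * b + u 0 a b c) (a * c + u 4 a b c) (b * c + u 5 a b c)
        (q 0 4 + q 4 0) (q 0 5 + q 5 0) (q 4 5 + q 5 4) x y z := by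
    intro a b c
    refine ⟨p ![0, a, b, c, 0, 0], fun x y z => ?_⟩
    simp [h, ternaryQuadratic, u, Fin.sum_univ_six]
    linear_combination q 0 0 * hsq x + q 4 4 * hsq y + q 5 5 * hsq z
  rw [wt_eq_sum_val, sum_fin_six_fun]
  choose K hK using hblock
  simp only [hK]
  by_cases hQ : (q 0 4 + q 4 0, q 0 5 + q 5 0, q 4 5 + q 5 4) = 0
  · simp only [Prod.mk_eq_zero] at hQ
    simp only [hQ]
    refine (sixteen_le_sum_sum_dot
      ![l 0 + q 0 0, q 0 1 + q 1 0, q 0 2 + q 2 0, q 0 3 + q 3 0]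
      ![l 4 + q 4 4, q 4 1 + q 1 4, q 4 2 + q 2 4, q 4 3 + q 3 4]
      ![l 5 + q 5 5, q 5 1 + q 1 5, q 5 2 + q 2 5, q 5 3 + q 3 5]).trans ?_
    refine Finset.sum_le_sum fun a _ => Finset.sum_le_sum fun b _ => Finset.sum_le_sum fun c _ =>
      le_of_eq_of_le ?_ (sum_dot_le_sum_ternaryQuadratic _ _ _ _)
    simp [u, add_assoc]
  · calc 16 = ∑ _a : ZMod 2, ∑ _b : ZMod 2, ∑ _c : ZMod 2, 2 := by simp
      _ ≤ _ := Finset.sum_le_sum fun a _ => Finset.sum_le_sum fun b _ =>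
        Finset.sum_le_sum fun c _ => two_le_sum_ternaryQuadratic _ _ _ _ _ _ _ hQ

/-- The distance from `f₅ = X₁X₂X₃ + X₂X₄X₅ + X₃X₄X₆` to `RM(2,6)` equals 16. -/
theorem stmt13 :
    distRM 6 2 (fun v : Fin 6 → ZMod 2 =>
      v 0 * v 1 * v 2 + v 1 * v 3 * v 4 + v 2 * v 3 * v 5) = 16 := by
  have hmem : 16 ∈ {w | ∃ p : BF 6, deg p ≤ 2 ∧ wt ((fun v : Fin 6 → ZMod 2 =>
      v 0 * v 1 * v 2 + v 1 * v 3 * v 4 + v 2 * v 3 * v 5) + p) = w} := by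
    refine ⟨0, by simp [deg, repPoly], ?_⟩
    rw [add_zero, wt_eq_sum_val, sum_fin_six_fun]
    decide +kernel
  refine le_antisymm (Nat.sInf_le hmem) (le_csInf ⟨16, hmem⟩ ?_)
  rintro w ⟨p, hp, rfl⟩
  exact sixteen_le_wt_add_of_isQuadratic (isQuadratic_of_deg_le_two hp)
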